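/- arXiv:2605.01079 — 3 statements merged into one kernel-verified Lean document; each statement's English description precedes it below -/
import Mathlib

section
/- Convolution-to-sum identity for rationally related orders (P functions): let n, m be coprime positive integers, let α, β > 0 with mα = nβ, let λ, σ ∈ ℂ with λ^m ≠ σ^n, let w₁, w₂ > −1, and set w = w₁ + w₂. Then for every t > 0, ∫_0^t P_{α,w₁}(λ,t−τ) P_{β,w₂}(σ,τ) dτ = ∑_{j=0}^{n−1} (σ^j λ^m/(λ^m − σ^n)) P_{α, w+1+βj}(λ,t) + ∑_{k=0}^{m−1} (λ^k σ^n/(σ^n − λ^m)) P_{β, w+1+αk}(σ,t); in particular the convolution is a sum of n + m P functions. -/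
open MeasureTheory

/-- Two-parameter Mittag-Leffler function, using the entire reciprocal Gamma
function (Mathlib's `Complex.Gamma` vanishes at nonpositive integers, so its
inverse is the entire reciprocal Gamma). -/
noncomputable def mlE (α β : ℝ) (z : ℂ) : ℂ :=
  ∑' n : ℕ, z ^ n * (Complex.Gamma ((α * n + β : ℝ) : ℂ))⁻¹

/-- The `P` function: `P_{α,w}(λ,t) = t^w E_{α,w+1}(λ t^α)`. -/
noncomputable def Pfun (α w : ℝ) (lam : ℂ) (t : ℝ) : ℂ :=
  ((t ^ w : ℝ) : ℂ) * mlE α (w + 1) (lam * ((t ^ α : ℝ) : ℂ))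

/-- The `R` (Lorenzo–Hartley) function: `R_{α,v}(λ,t) = t^{α-v-1} E_{α,α-v}(λ t^α)`. -/
noncomputable def Rfun (α v : ℝ) (lam : ℂ) (t : ℝ) : ℂ :=
  ((t ^ (α - v - 1) : ℝ) : ℂ) * mlE α (α - v) (lam * ((t ^ α : ℝ) : ℂ))

/-- Exponentials grow more slowly than the Gamma function. -/
theorem exists_rpow_le_mul_Gamma {c R : ℝ} (hc : 0 < c) (hR : 0 < R) :
    ∃ K : ℝ, 0 < K ∧ ∀ x : ℝ, 0 ≤ x → R ^ x * (Real.Gamma (x + c))⁻¹ ≤ K := by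
  have hint : IntegrableOn (fun u : ℝ => Real.exp (-u) * u ^ (c - 1)) (Set.Ioi R) :=
    (Real.GammaIntegral_convergent hc).mono_set (Set.Ioi_subset_Ioi hR.le)
  have hpos : 0 < ∫ u in Set.Ioi R, Real.exp (-u) * u ^ (c - 1) := by
    refine (integral_pos_iff_support_of_nonneg_ae ?_ hint).2 ?_
    · filter_upwards [ae_restrict_mem measurableSet_Ioi] with u hu
      have : 0 < u := hR.trans hu
      simp only [Pi.zero_apply]
      positivity
    · have hsub : Set.Ioi R ⊆ Function.support fun u : ℝ => Real.exp (-u) * u ^ (c - 1) := by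
        intro u hu
        have : 0 < u := hR.trans hu
        simp only [Function.mem_support]
        positivity
      rw [Measure.restrict_apply' measurableSet_Ioi, Set.inter_eq_right.2 hsub]
      simp
  refine ⟨(∫ u in Set.Ioi R, Real.exp (-u) * u ^ (c - 1))⁻¹, inv_pos.2 hpos, fun x hx => ?_⟩
  have hxc : 0 < x + c := by linarith
  have hle : R ^ x * ∫ u in Set.Ioi R, Real.exp (-u) * u ^ (c - 1) ≤ Real.Gamma (x + c) := by
    rw [Real.Gamma_eq_integral hxc, ← integral_const_mul]
    calc ∫ u in Set.Ioi R, R ^ x * (Real.exp (-u) * u ^ (c - 1))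
        ≤ ∫ u in Set.Ioi R, Real.exp (-u) * u ^ (x + c - 1) := by
          refine setIntegral_mono_on (hint.const_mul _)
            ((Real.GammaIntegral_convergent hxc).mono_set (Set.Ioi_subset_Ioi hR.le))
            measurableSet_Ioi fun u hu => ?_
          have hu0 : 0 < u := hR.trans hu
          rw [add_sub_assoc, Real.rpow_add hu0, mul_left_comm]
          gcongr
          exact le_of_lt hu
      _ ≤ ∫ u in Set.Ioi (0 : ℝ), Real.exp (-u) * u ^ (x + c - 1) := by
          refine setIntegral_mono_set (Real.GammaIntegral_convergent hxc) ?_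
            (Set.Ioi_subset_Ioi hR.le).eventuallyLE
          filter_upwards [ae_restrict_mem measurableSet_Ioi] with u hu
          have : 0 < u := hu
          simp only [Pi.zero_apply]
          positivity
  rw [← div_eq_mul_inv, ← one_div, div_le_div_iff₀ (Real.Gamma_pos_of_pos hxc) hpos]
  linarith

/-- The double power series with coefficients `1 / Γ(αa + βb + c)` converges absolutely. -/
theorem summable_pow_mul_pow_mul_inv_Gamma {α β c x y : ℝ} (hα : 0 < α) (hβ : 0 < β)
    (hc : 0 < c) (hx : 0 ≤ x) (hy : 0 ≤ y) :
    Summable fun p : ℕ × ℕ => x ^ p.1 * y ^ p.2 * (Real.Gamma (α * p.1 + β * p.2 + c))⁻¹ := by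
  obtain ⟨R, hR, hxR, hyR⟩ : ∃ R : ℝ, 0 < R ∧ 2 * x ≤ R ^ α ∧ 2 * y ≤ R ^ β := by
    have h1 := (tendsto_rpow_atTop hα).eventually_ge_atTop (2 * x)
    have h2 := (tendsto_rpow_atTop hβ).eventually_ge_atTop (2 * y)
    exact ((Filter.eventually_gt_atTop 0).and (h1.and h2)).exists
  obtain ⟨K, hK, hbound⟩ := exists_rpow_le_mul_Gamma hc hR
  have hgeo : Summable fun p : ℕ × ℕ => ((1 / 2 : ℝ) ^ p.1) * ((1 / 2 : ℝ) ^ p.2) :=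
    summable_geometric_two.mul_of_nonneg summable_geometric_two
      (fun _ => by positivity) (fun _ => by positivity)
  refine Summable.of_nonneg_of_le (fun p => ?_) (fun p => ?_) (hgeo.mul_left K)
  · have := (Real.Gamma_pos_of_pos (show 0 < α * p.1 + β * p.2 + c by positivity)).le
    positivity
  · obtain ⟨a, b⟩ := p
    have hG := (Real.Gamma_pos_of_pos (show 0 < α * a + β * b + c by positivity)).le
    have hxa : x ^ a ≤ (1 / 2) ^ a * R ^ (α * a) := by
      rw [Real.rpow_mul hR.le, Real.rpow_natCast, ← mul_pow]
      exact pow_le_pow_left₀ hx (by linarith) a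
    have hyb : y ^ b ≤ (1 / 2) ^ b * R ^ (β * b) := by
      rw [Real.rpow_mul hR.le, Real.rpow_natCast, ← mul_pow]
      exact pow_le_pow_left₀ hy (by linarith) b
    calc x ^ a * y ^ b * (Real.Gamma (α * a + β * b + c))⁻¹
        ≤ ((1 / 2) ^ a * R ^ (α * a)) * ((1 / 2) ^ b * R ^ (β * b)) *
          (Real.Gamma (α * a + β * b + c))⁻¹ := by gcongr
      _ = (R ^ (α * a + β * b) * (Real.Gamma (α * a + β * b + c))⁻¹) *
          ((1 / 2) ^ a * (1 / 2) ^ b) := by rw [Real.rpow_add hR]; ring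
      _ ≤ K * ((1 / 2) ^ a * (1 / 2) ^ b) := by
          gcongr
          exact hbound _ (by positivity)

/-- The real coefficient `t ^ s / Γ(s + 1)` of the `P` functions. -/
noncomputable def fracMonomial (s t : ℝ) : ℝ := t ^ s * (Real.Gamma (s + 1))⁻¹

theorem fracMonomial_nonneg {s t : ℝ} (hs : -1 < s) (ht : 0 ≤ t) : 0 ≤ fracMonomial s t := by
  have := (Real.Gamma_pos_of_pos (show 0 < s + 1 by linarith)).le
  unfold fracMonomial
  positivity

theorem summable_pow_mul_pow_mul_fracMonomial {α β w x y t : ℝ} (hα : 0 < α) (hβ : 0 < β)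
    (hw : -1 < w) (hx : 0 ≤ x) (hy : 0 ≤ y) (ht : 0 < t) :
    Summable fun p : ℕ × ℕ => x ^ p.1 * y ^ p.2 * fracMonomial (α * p.1 + β * p.2 + w) t := by
  have h := (summable_pow_mul_pow_mul_inv_Gamma (c := w + 1) (x := x * t ^ α) (y := y * t ^ β)
    hα hβ (by linarith) (by positivity) (by positivity)).mul_left (t ^ w)
  refine h.congr fun p => ?_
  rw [fracMonomial, Real.rpow_add ht, Real.rpow_add ht, Real.rpow_mul ht.le, Real.rpow_mul ht.le,
    Real.rpow_natCast, Real.rpow_natCast, add_assoc _ w 1]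
  ring

theorem summable_norm_pow_mul_fracMonomial {α w t : ℝ} (lam : ℂ) (hα : 0 < α) (hw : -1 < w)
    (ht : 0 < t) :
    Summable fun n : ℕ => ‖lam ^ n * (fracMonomial (α * n + w) t : ℂ)‖ := by
  have h := (summable_pow_mul_pow_mul_fracMonomial (y := 0) hα one_pos hw (norm_nonneg lam)
    le_rfl ht).comp_injective (Prod.mk_left_injective (0 : ℕ))
  refine h.congr fun n => ?_
  have h0 := fracMonomial_nonneg (s := α * n + w) (by nlinarith [Nat.cast_nonneg (α := ℝ) n]) ht.le
  simp [abs_of_nonneg h0]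

theorem Pfun_eq_tsum {α w t : ℝ} (lam : ℂ) (ht : 0 < t) :
    Pfun α w lam t = ∑' n : ℕ, lam ^ n * (fracMonomial (α * n + w) t : ℂ) := by
  rw [Pfun, mlE, ← tsum_mul_left]
  refine tsum_congr fun n => ?_
  rw [fracMonomial, Real.rpow_add ht, Real.rpow_mul ht.le, Real.rpow_natCast, Complex.Gamma_ofReal,
    add_assoc]
  push_cast
  ring

/-- The convolution of two fractional monomials is a fractional monomial. -/
theorem integral_fracMonomial_mul {p q t : ℝ} (hp : -1 < p) (hq : -1 < q) (ht : 0 < t) :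
    ∫ τ in (0 : ℝ)..t, fracMonomial p (t - τ) * fracMonomial q τ = fracMonomial (p + q + 1) t := by
  have hp' : 0 < p + 1 := by linarith
  have hq' : 0 < q + 1 := by linarith
  have hG := Complex.Gamma_mul_Gamma_eq_betaIntegral (s := ((q + 1 : ℝ) : ℂ))
    (t := ((p + 1 : ℝ) : ℂ)) (by simpa using hq') (by simpa using hp')
  have hB := Complex.betaIntegral_scaled ((q + 1 : ℝ) : ℂ) ((p + 1 : ℝ) : ℂ) ht
  have hcast : ((∫ τ in (0 : ℝ)..t, τ ^ q * (t - τ) ^ p : ℝ) : ℂ) =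
      ∫ τ in (0 : ℝ)..t, (τ : ℂ) ^ (((q + 1 : ℝ) : ℂ) - 1) *
        ((t : ℂ) - τ) ^ (((p + 1 : ℝ) : ℂ) - 1) := by
    rw [← intervalIntegral.integral_ofReal]
    refine intervalIntegral.integral_congr fun τ hτ => ?_
    rw [Set.uIcc_of_le ht.le] at hτ
    have h1 : (((q + 1 : ℝ) : ℂ) - 1) = (q : ℂ) := by push_cast; ring
    have h2 : (((p + 1 : ℝ) : ℂ) - 1) = (p : ℂ) := by push_cast; ring
    simp only [h1, h2]
    rw [Complex.ofReal_mul, Complex.ofReal_cpow hτ.1, Complex.ofReal_cpow (sub_nonneg.2 hτ.2),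
      Complex.ofReal_sub]
  have hpow : (t : ℂ) ^ (((q + 1 : ℝ) : ℂ) + ((p + 1 : ℝ) : ℂ) - 1) =
      ((t ^ (p + q + 1) : ℝ) : ℂ) := by
    rw [Complex.ofReal_cpow ht.le]
    congr 1
    push_cast
    ring
  rw [← hcast, hpow] at hB
  rw [← Complex.ofReal_add, Complex.Gamma_ofReal, Complex.Gamma_ofReal, Complex.Gamma_ofReal] at hG
  have hGp := (Real.Gamma_pos_of_pos hp').ne'
  have hGq := (Real.Gamma_pos_of_pos hq').ne'
  have hGs := (Real.Gamma_pos_of_pos (show 0 < q + 1 + (p + 1) by linarith)).ne'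
  have hint : ∫ τ in (0 : ℝ)..t, τ ^ q * (t - τ) ^ p =
      t ^ (p + q + 1) * (Real.Gamma (q + 1) * Real.Gamma (p + 1) /
        Real.Gamma (q + 1 + (p + 1))) := by
    apply Complex.ofReal_injective
    rw [hB, Complex.ofReal_mul, Complex.ofReal_div, Complex.ofReal_mul, hG,
      mul_div_cancel_left₀ _ (by exact_mod_cast hGs)]
  have hfun : (fun τ : ℝ => fracMonomial p (t - τ) * fracMonomial q τ) = fun τ : ℝ =>
      ((Real.Gamma (p + 1))⁻¹ * (Real.Gamma (q + 1))⁻¹) * (τ ^ q * (t - τ) ^ p) := by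
    ext τ
    rw [fracMonomial, fracMonomial]
    ring
  rw [hfun, intervalIntegral.integral_const_mul, hint, fracMonomial,
    show p + q + 1 + 1 = q + 1 + (p + 1) by ring]
  field_simp

theorem intervalIntegrable_fracMonomial_mul {p q t : ℝ} (hp : -1 < p) (hq : -1 < q)
    (ht : 0 < t) :
    IntervalIntegrable (fun τ => fracMonomial p (t - τ) * fracMonomial q τ) volume 0 t := by
  apply intervalIntegral.intervalIntegrable_of_integral_ne_zero
  rw [integral_fracMonomial_mul hp hq ht, fracMonomial]
  have := Real.Gamma_pos_of_pos (show 0 < p + q + 1 + 1 by linarith)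
  positivity

/-- The convolution of two `P` functions as an absolutely convergent double series. -/
theorem integral_Pfun_mul_Pfun {α β w₁ w₂ t : ℝ} (lam sig : ℂ) (hα : 0 < α) (hβ : 0 < β)
    (hw₁ : -1 < w₁) (hw₂ : -1 < w₂) (ht : 0 < t) :
    (∫ τ in (0 : ℝ)..t, Pfun α w₁ lam (t - τ) * Pfun β w₂ sig τ) =
      ∑' p : ℕ × ℕ, lam ^ p.1 * sig ^ p.2 *
        (fracMonomial (α * p.1 + β * p.2 + (w₁ + w₂ + 1)) t : ℂ) := by
  have hp (a : ℕ) : -1 < α * a + w₁ := by nlinarith [Nat.cast_nonneg (α := ℝ) a]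
  have hq (b : ℕ) : -1 < β * b + w₂ := by nlinarith [Nat.cast_nonneg (α := ℝ) b]
  set F : ℕ × ℕ → ℝ → ℂ := fun p τ => lam ^ p.1 * sig ^ p.2 *
    ((fracMonomial (α * p.1 + w₁) (t - τ) * fracMonomial (β * p.2 + w₂) τ : ℝ) : ℂ) with hF
  have hreal (p : ℕ × ℕ) : IntegrableOn (fun τ => fracMonomial (α * p.1 + w₁) (t - τ) *
      fracMonomial (β * p.2 + w₂) τ) (Set.Ioo 0 t) :=
    ((intervalIntegrable_iff_integrableOn_Ioo_of_le ht.le).1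
      (intervalIntegrable_fracMonomial_mul (hp p.1) (hq p.2) ht))
  have hval (p : ℕ × ℕ) : ∫ τ in Set.Ioo 0 t, fracMonomial (α * p.1 + w₁) (t - τ) *
      fracMonomial (β * p.2 + w₂) τ = fracMonomial (α * p.1 + β * p.2 + (w₁ + w₂ + 1)) t := by
    rw [← integral_Ioc_eq_integral_Ioo, ← intervalIntegral.integral_of_le ht.le,
      integral_fracMonomial_mul (hp p.1) (hq p.2) ht]
    congr 1
    ring
  have hFint (p : ℕ × ℕ) : Integrable (F p) (volume.restrict (Set.Ioo 0 t)) :=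
    (Integrable.ofReal (hreal p)).const_mul _
  have hnorm (p : ℕ × ℕ) : ∫ τ in Set.Ioo 0 t, ‖F p τ‖ =
      ‖lam‖ ^ p.1 * ‖sig‖ ^ p.2 * fracMonomial (α * p.1 + β * p.2 + (w₁ + w₂ + 1)) t := by
    rw [← hval, ← integral_const_mul]
    refine setIntegral_congr_fun measurableSet_Ioo fun τ hτ => ?_
    have h1 := fracMonomial_nonneg (hp p.1) (sub_nonneg.2 hτ.2.le)
    have h2 := fracMonomial_nonneg (hq p.2) hτ.1.le
    simp only [hF]
    rw [norm_mul, norm_mul, norm_pow, norm_pow, Complex.norm_real,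
      Real.norm_of_nonneg (mul_nonneg h1 h2)]
  have hsum := hasSum_integral_of_summable_integral_norm hFint (by
    simp only [hnorm]
    exact summable_pow_mul_pow_mul_fracMonomial hα hβ (by linarith) (norm_nonneg _)
      (norm_nonneg _) ht)
  rw [intervalIntegral.integral_of_le ht.le, integral_Ioc_eq_integral_Ioo]
  calc ∫ τ in Set.Ioo 0 t, Pfun α w₁ lam (t - τ) * Pfun β w₂ sig τ
      = ∫ τ in Set.Ioo 0 t, ∑' p, F p τ := by
        refine setIntegral_congr_fun measurableSet_Ioo fun τ hτ => ?_
        have h1 := sub_pos.2 hτ.2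
        simp only [hF]
        rw [Pfun_eq_tsum lam h1, Pfun_eq_tsum sig hτ.1, tsum_mul_tsum_of_summable_norm
          (summable_norm_pow_mul_fracMonomial lam hα hw₁ h1)
          (summable_norm_pow_mul_fracMonomial sig hβ hw₂ hτ.1)]
        refine tsum_congr fun p => ?_
        push_cast
        ring
    _ = ∑' p, ∫ τ in Set.Ioo 0 t, F p τ := hsum.tsum_eq.symm
    _ = _ := by
        refine tsum_congr fun p => ?_
        simp only [hF]
        rw [integral_const_mul, integral_complex_ofReal, hval]

/-- Splitting off the first `k` rows of a double series. -/
theorem sum_add_tsum_tsum_nat_add {f : ℕ → ℕ → ℂ} (k : ℕ)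
    (hf : Summable fun p : ℕ × ℕ => f p.1 p.2) :
    (∑ i ∈ Finset.range k, ∑' b, f i b) + ∑' p : ℕ × ℕ, f (p.1 + k) p.2 =
      ∑' p : ℕ × ℕ, f p.1 p.2 := by
  have hinj : Function.Injective fun p : ℕ × ℕ => (p.1 + k, p.2) := by
    rintro ⟨a, b⟩ ⟨c, d⟩ h
    simpa using h
  have hshift : Summable fun p : ℕ × ℕ => f (p.1 + k) p.2 := hf.comp_injective hinj
  rw [hf.tsum_prod, hshift.tsum_prod]
  exact hf.prod.sum_add_tsum_nat_add k

/-- A double power series whose coefficients satisfy `g (a + m) b = g a (b + n)` reduces to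
`n + m` single power series. -/
theorem tsum_prod_eq_sum_add_sum {n m : ℕ} {x y : ℂ} (hxy : x ^ m ≠ y ^ n) {g : ℕ → ℕ → ℂ}
    (hg : ∀ a b, g (a + m) b = g a (b + n))
    (hs : Summable fun p : ℕ × ℕ => x ^ p.1 * y ^ p.2 * g p.1 p.2) :
    ∑' p : ℕ × ℕ, x ^ p.1 * y ^ p.2 * g p.1 p.2 =
      (∑ j ∈ Finset.range n, y ^ j * x ^ m / (x ^ m - y ^ n) * ∑' a, x ^ a * g a j) +
        ∑ k ∈ Finset.range m, x ^ k * y ^ n / (y ^ n - x ^ m) * ∑' b, y ^ b * g k b := by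
  set S := ∑' p : ℕ × ℕ, x ^ p.1 * y ^ p.2 * g p.1 p.2 with hS
  have hs' : Summable fun p : ℕ × ℕ => x ^ p.2 * y ^ p.1 * g p.2 p.1 := hs.prod_symm
  have hrow : (∑ k ∈ Finset.range m, ∑' b, x ^ k * y ^ b * g k b) +
      ∑' p : ℕ × ℕ, x ^ (p.1 + m) * y ^ p.2 * g (p.1 + m) p.2 = S :=
    sum_add_tsum_tsum_nat_add (f := fun a b => x ^ a * y ^ b * g a b) m hs
  have hcol : (∑ j ∈ Finset.range n, ∑' a, x ^ a * y ^ j * g a j) +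
      ∑' p : ℕ × ℕ, x ^ p.2 * y ^ (p.1 + n) * g p.2 (p.1 + n) = S := by
    rw [hS, ← (Equiv.prodComm ℕ ℕ).tsum_eq fun p : ℕ × ℕ => x ^ p.1 * y ^ p.2 * g p.1 p.2]
    exact sum_add_tsum_tsum_nat_add (f := fun b a => x ^ a * y ^ b * g a b) n hs'
  have htail : y ^ n * ∑' p : ℕ × ℕ, x ^ (p.1 + m) * y ^ p.2 * g (p.1 + m) p.2 =
      x ^ m * ∑' p : ℕ × ℕ, x ^ p.2 * y ^ (p.1 + n) * g p.2 (p.1 + n) := by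
    rw [← (Equiv.prodComm ℕ ℕ).tsum_eq fun p : ℕ × ℕ => x ^ (p.1 + m) * y ^ p.2 * g (p.1 + m) p.2,
      ← tsum_mul_left, ← tsum_mul_left]
    refine tsum_congr fun p => ?_
    simp only [Equiv.prodComm_apply, Prod.fst_swap, Prod.snd_swap, hg]
    ring
  have hA : ∑ j ∈ Finset.range n, y ^ j * x ^ m / (x ^ m - y ^ n) * ∑' a, x ^ a * g a j =
      x ^ m / (x ^ m - y ^ n) * ∑ j ∈ Finset.range n, ∑' a, x ^ a * y ^ j * g a j := by
    rw [Finset.mul_sum]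
    refine Finset.sum_congr rfl fun j _ => ?_
    rw [← tsum_mul_left, ← tsum_mul_left]
    refine tsum_congr fun a => ?_
    ring
  have hB : ∑ k ∈ Finset.range m, x ^ k * y ^ n / (y ^ n - x ^ m) * ∑' b, y ^ b * g k b =
      y ^ n / (y ^ n - x ^ m) * ∑ k ∈ Finset.range m, ∑' b, x ^ k * y ^ b * g k b := by
    rw [Finset.mul_sum]
    refine Finset.sum_congr rfl fun k _ => ?_
    rw [← tsum_mul_left, ← tsum_mul_left]
    refine tsum_congr fun b => ?_
    ring
  have h1 : x ^ m - y ^ n ≠ 0 := sub_ne_zero.2 hxy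
  rw [hA, hB, ← neg_sub (x ^ m) (y ^ n), div_neg, eq_sub_of_add_eq hrow, eq_sub_of_add_eq hcol]
  field_simp
  linear_combination -htail

/-- Convolution-to-sum identity for rationally related orders
(`P` functions): if `n, m` are coprime positive integers, `mα = nβ`, and
`λ^m ≠ σ^n`, then the convolution of `P_{α,w₁}(λ,·)` and `P_{β,w₂}(σ,·)` is a
sum of `n + m` `P` functions. -/
theorem conv_Pfun_rational_orders (n m : ℕ) (hn : 0 < n) (hm : 0 < m)
    (hcop : Nat.Coprime n m) (α β : ℝ) (hα : 0 < α) (hβ : 0 < β)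
    (hαβ : (m : ℝ) * α = (n : ℝ) * β) (lam sig : ℂ) (hls : lam ^ m ≠ sig ^ n)
    (w₁ w₂ : ℝ) (hw₁ : -1 < w₁) (hw₂ : -1 < w₂) (t : ℝ) (ht : 0 < t) :
    (∫ τ in (0 : ℝ)..t, Pfun α w₁ lam (t - τ) * Pfun β w₂ sig τ) =
      (∑ j ∈ Finset.range n,
        (sig ^ j * lam ^ m / (lam ^ m - sig ^ n)) *
          Pfun α ((w₁ + w₂) + 1 + β * (j : ℝ)) lam t) +
      ∑ k ∈ Finset.range m,
        (lam ^ k * sig ^ n / (sig ^ n - lam ^ m)) *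
          Pfun β ((w₁ + w₂) + 1 + α * (k : ℝ)) sig t := by
  rw [integral_Pfun_mul_Pfun lam sig hα hβ hw₁ hw₂ ht]
  have hs : Summable fun p : ℕ × ℕ => lam ^ p.1 * sig ^ p.2 *
      (fracMonomial (α * p.1 + β * p.2 + (w₁ + w₂ + 1)) t : ℂ) := by
    refine Summable.of_norm ((summable_pow_mul_pow_mul_fracMonomial hα hβ
      (show -1 < w₁ + w₂ + 1 by linarith) (norm_nonneg lam) (norm_nonneg sig) ht).congr
      fun p => ?_)
    have h0 := fracMonomial_nonneg (s := α * p.1 + β * p.2 + (w₁ + w₂ + 1)) (t := t)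
      (by have : 0 ≤ α * p.1 + β * p.2 := by positivity
          linarith) ht.le
    rw [norm_mul, norm_mul, norm_pow, norm_pow, Complex.norm_real, Real.norm_of_nonneg h0]
  rw [tsum_prod_eq_sum_add_sum
    (g := fun a b => (fracMonomial (α * a + β * b + (w₁ + w₂ + 1)) t : ℂ)) hls ?_ hs]
  · congr 1
    · refine Finset.sum_congr rfl fun j _ => ?_
      rw [Pfun_eq_tsum lam ht]
      congr 1
      refine tsum_congr fun a => ?_
      ring_nf
    · refine Finset.sum_congr rfl fun k _ => ?_
      rw [Pfun_eq_tsum sig ht]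
      congr 1
      refine tsum_congr fun b => ?_
      ring_nf
  · intro a b
    congr 2
    push_cast
    linear_combination hαβ
end

section
/- Convolution-to-sum identity for rationally related orders (R functions): let n, m be coprime positive integers, let α, β > 0 with mα = nβ, let λ, σ ∈ ℂ with λ^m ≠ σ^n, let v₁ < α, v₂ < β, and set v = v₁ + v₂. Then for every t > 0, ∫_0^t R_{α,v₁}(λ,t−τ) R_{β,v₂}(σ,τ) dτ = ∑_{j=0}^{n−1} (σ^j λ^m/(λ^m − σ^n)) R_{α, v−β(j+1)}(λ,t) + ∑_{k=0}^{m−1} (λ^k σ^n/(σ^n − λ^m)) R_{β, v−α(k+1)}(σ,t). -/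
open MeasureTheory

open Filter Topology

/-- The fractional-integration kernel `s^{p-1} / Γ(p)`. -/
noncomputable def fracKernel (p s : ℝ) : ℂ :=
  ((s ^ (p - 1) : ℝ) : ℂ) * (Complex.Gamma (p : ℂ))⁻¹

theorem Rfun_eq_tsum_fracKernel (α v : ℝ) (lam : ℂ) {t : ℝ} (ht : 0 < t) :
    Rfun α v lam t = ∑' n : ℕ, lam ^ n * fracKernel (α * n + (α - v)) t := by
  unfold Rfun mlE fracKernel
  rw [← tsum_mul_left]
  refine tsum_congr fun n => ?_
  rw [show α * n + (α - v) - 1 = (α - v - 1) + α * n by ring, Real.rpow_add ht,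
    Real.rpow_mul ht.le, Real.rpow_natCast]
  push_cast
  ring

theorem exp_neg_mul_rpow_le_Gamma {M x : ℝ} (hM : 0 < M) (hx : 1 ≤ x) :
    Real.exp (-M) * M ^ (x - 1) ≤ Real.Gamma x := by
  have hx0 : 0 < x := by linarith
  have hint := Real.GammaIntegral_convergent hx0
  have hsub : Set.Ioi M ⊆ Set.Ioi (0 : ℝ) := Set.Ioi_subset_Ioi hM.le
  rw [Real.Gamma_eq_integral hx0]
  calc Real.exp (-M) * M ^ (x - 1)
      = ∫ u in Set.Ioi M, Real.exp (-u) * M ^ (x - 1) := by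
        rw [integral_mul_const, integral_exp_neg_Ioi]
    _ ≤ ∫ u in Set.Ioi M, Real.exp (-u) * u ^ (x - 1) := by
        refine setIntegral_mono_on ((integrableOn_exp_neg_Ioi M).mul_const _)
          (hint.mono_set hsub) measurableSet_Ioi fun u hu => ?_
        have hu : M < u := hu
        gcongr
    _ ≤ ∫ u in Set.Ioi 0, Real.exp (-u) * u ^ (x - 1) := by
        refine setIntegral_mono_set hint ?_ hsub.eventuallyLE
        filter_upwards [ae_restrict_mem measurableSet_Ioi] with u hu
        have hu : 0 < u := hu
        positivity

theorem summable_pow_mul_inv_Gamma {α : ℝ} (hα : 0 < α) (c : ℝ) {z : ℝ} (hz : 0 ≤ z) :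
    Summable fun n : ℕ => z ^ n * (Real.Gamma (α * n + c))⁻¹ := by
  obtain ⟨M, hzM, hM⟩ := (((tendsto_rpow_atTop hα).eventually_ge_atTop (2 * z)).and
    (eventually_gt_atTop 0)).exists
  have hlim : Tendsto (fun n : ℕ => α * n + c) atTop atTop :=
    tendsto_atTop_add_const_right _ _ (tendsto_natCast_atTop_atTop.const_mul_atTop hα)
  refine Summable.of_norm_bounded_eventually_nat
    (g := fun n : ℕ => (Real.exp (-M) * M ^ (c - 1))⁻¹ * (1 / 2) ^ n)
    (summable_geometric_two.mul_left _) ?_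
  filter_upwards [hlim.eventually_ge_atTop 1] with n hn
  have hG : 0 < Real.Gamma (α * n + c) := Real.Gamma_pos_of_pos (by linarith)
  have hlow := exp_neg_mul_rpow_le_Gamma hM hn
  rw [show α * n + c - 1 = (c - 1) + α * n by ring, Real.rpow_add hM, Real.rpow_mul hM.le,
    Real.rpow_natCast] at hlow
  have hMα : 0 < M ^ α := Real.rpow_pos_of_pos hM α
  rw [Real.norm_of_nonneg (by positivity)]
  calc z ^ n * (Real.Gamma (α * n + c))⁻¹
      ≤ (M ^ α / 2) ^ n * (Real.exp (-M) * (M ^ (c - 1) * (M ^ α) ^ n))⁻¹ := by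
        gcongr
        linarith
    _ = (Real.exp (-M) * M ^ (c - 1))⁻¹ * (1 / 2) ^ n := by
        rw [div_pow, one_div, inv_pow]
        field_simp

theorem norm_fracKernel {p s : ℝ} (hp : 0 < p) (hs : 0 ≤ s) :
    ‖fracKernel p s‖ = s ^ (p - 1) * (Real.Gamma p)⁻¹ := by
  rw [fracKernel, Complex.Gamma_ofReal, norm_mul, norm_inv, Complex.norm_real, Complex.norm_real,
    Real.norm_of_nonneg (Real.rpow_nonneg hs _), Real.norm_of_nonneg (Real.Gamma_pos_of_pos hp).le]

theorem norm_pow_mul_fracKernel_le {α p s t : ℝ} (hα : 0 < α) (hp : 0 < p) (hs : 0 < s)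
    (hst : s ≤ t) (lam : ℂ) (n : ℕ) :
    ‖lam ^ n * fracKernel (α * n + p) s‖ ≤
      ((‖lam‖ * t ^ α) ^ n * (Real.Gamma (α * n + p))⁻¹) * s ^ (p - 1) := by
  have hpos : 0 < α * n + p := by positivity
  have hG := Real.Gamma_pos_of_pos hpos
  rw [norm_mul, norm_pow, norm_fracKernel hpos hs.le,
    show α * n + p - 1 = (p - 1) + α * n by ring, Real.rpow_add hs, Real.rpow_mul hs.le,
    Real.rpow_natCast, mul_pow]
  calc ‖lam‖ ^ n * (s ^ (p - 1) * (s ^ α) ^ n * (Real.Gamma (α * n + p))⁻¹)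
      = (‖lam‖ ^ n * (s ^ α) ^ n * (Real.Gamma (α * n + p))⁻¹) * s ^ (p - 1) := by ring
    _ ≤ _ := by gcongr

theorem summable_norm_pow_mul_fracKernel {α p s : ℝ} (hα : 0 < α) (hp : 0 < p) (hs : 0 < s)
    (lam : ℂ) : Summable fun n : ℕ => ‖lam ^ n * fracKernel (α * n + p) s‖ :=
  Summable.of_nonneg_of_le (fun _ => norm_nonneg _)
    (fun n => norm_pow_mul_fracKernel_le hα hp hs le_rfl lam n)
    ((summable_pow_mul_inv_Gamma hα p (by positivity)).mul_right _)

theorem integral_rpow_mul_rpow {p q t : ℝ} (hp : 0 < p) (hq : 0 < q) (ht : 0 < t) :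
    ∫ τ in (0 : ℝ)..t, (t - τ) ^ (p - 1) * τ ^ (q - 1) =
      t ^ (p + q - 1) * (Real.Gamma p * Real.Gamma q / Real.Gamma (p + q)) := by
  have hB := Complex.betaIntegral_scaled (q : ℂ) (p : ℂ) ht
  have hG := Complex.Gamma_mul_Gamma_eq_betaIntegral (s := (q : ℂ)) (t := (p : ℂ))
    (by simpa using hq) (by simpa using hp)
  have hne : Real.Gamma (p + q) ≠ 0 := (Real.Gamma_pos_of_pos (by positivity)).ne'
  have hne' : (Real.Gamma (p + q) : ℂ) ≠ 0 := by exact_mod_cast hne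
  rw [← Complex.ofReal_add, add_comm q p, Complex.Gamma_ofReal, Complex.Gamma_ofReal,
    Complex.Gamma_ofReal] at hG
  have hB' : Complex.betaIntegral q p =
      ((Real.Gamma p * Real.Gamma q / Real.Gamma (p + q) : ℝ) : ℂ) := by
    push_cast
    rw [eq_div_iff hne', mul_comm, ← hG, mul_comm]
  apply Complex.ofReal_injective
  rw [← intervalIntegral.integral_ofReal, Complex.ofReal_mul, ← hB', Complex.ofReal_cpow ht.le]
  push_cast
  rw [add_comm (p : ℂ) q, ← hB]
  refine intervalIntegral.integral_congr fun τ hτ => ?_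
  rw [Set.uIcc_of_le ht.le] at hτ
  rw [Complex.ofReal_cpow (sub_nonneg.2 hτ.2), Complex.ofReal_cpow hτ.1]
  push_cast
  ring

theorem intervalIntegrable_rpow_mul_rpow {p q t : ℝ} (hp : 0 < p) (hq : 0 < q) (ht : 0 < t) :
    IntervalIntegrable (fun τ => (t - τ) ^ (p - 1) * τ ^ (q - 1)) volume 0 t := by
  by_contra h
  have h0 := integral_rpow_mul_rpow hp hq ht
  rw [intervalIntegral.integral_undef h] at h0
  have := Real.Gamma_pos_of_pos hp
  have := Real.Gamma_pos_of_pos hq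
  have := Real.Gamma_pos_of_pos (add_pos hp hq)
  have : 0 < t ^ (p + q - 1) * (Real.Gamma p * Real.Gamma q / Real.Gamma (p + q)) := by positivity
  linarith

theorem fracKernel_mul_fracKernel (p q s r : ℝ) :
    fracKernel p s * fracKernel q r =
      ((s ^ (p - 1) * r ^ (q - 1) : ℝ) : ℂ) *
        ((Complex.Gamma p)⁻¹ * (Complex.Gamma q)⁻¹) := by
  unfold fracKernel
  push_cast
  ring

theorem intervalIntegrable_fracKernel_conv {p q t : ℝ} (hp : 0 < p) (hq : 0 < q) (ht : 0 < t) :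
    IntervalIntegrable (fun τ => fracKernel p (t - τ) * fracKernel q τ) volume 0 t := by
  simp only [fracKernel_mul_fracKernel]
  exact ((intervalIntegrable_iff.1 (intervalIntegrable_rpow_mul_rpow hp hq ht)).ofReal.mul_const _
    |> intervalIntegrable_iff.2)

theorem integral_fracKernel_conv {p q t : ℝ} (hp : 0 < p) (hq : 0 < q) (ht : 0 < t) :
    ∫ τ in (0 : ℝ)..t, fracKernel p (t - τ) * fracKernel q τ = fracKernel (p + q) t := by
  simp only [fracKernel_mul_fracKernel]
  rw [intervalIntegral.integral_mul_const, intervalIntegral.integral_ofReal,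
    integral_rpow_mul_rpow hp hq ht]
  have hGp : (Real.Gamma p : ℂ) ≠ 0 := by exact_mod_cast (Real.Gamma_pos_of_pos hp).ne'
  have hGq : (Real.Gamma q : ℂ) ≠ 0 := by exact_mod_cast (Real.Gamma_pos_of_pos hq).ne'
  rw [fracKernel, Complex.Gamma_ofReal, Complex.Gamma_ofReal, Complex.Gamma_ofReal]
  push_cast
  field_simp

theorem hasSum_Rfun_conv {α β : ℝ} (hα : 0 < α) (hβ : 0 < β) (lam sig : ℂ) {v₁ v₂ : ℝ}
    (hv₁ : v₁ < α) (hv₂ : v₂ < β) {t : ℝ} (ht : 0 < t) :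
    HasSum (fun i : ℕ × ℕ => lam ^ i.1 * sig ^ i.2 *
        fracKernel ((α * i.1 + (α - v₁)) + (β * i.2 + (β - v₂))) t)
      (∫ τ in (0 : ℝ)..t, Rfun α v₁ lam (t - τ) * Rfun β v₂ sig τ) := by
  have hp : 0 < α - v₁ := sub_pos.2 hv₁
  have hq : 0 < β - v₂ := sub_pos.2 hv₂
  let f : ℕ × ℕ → ℝ → ℂ := fun i τ =>
    (lam ^ i.1 * fracKernel (α * i.1 + (α - v₁)) (t - τ)) *
      (sig ^ i.2 * fracKernel (β * i.2 + (β - v₂)) τ)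
  have hf : ∀ i, f i = fun τ => (lam ^ i.1 * sig ^ i.2) *
      (fracKernel (α * i.1 + (α - v₁)) (t - τ) * fracKernel (β * i.2 + (β - v₂)) τ) := by
    intro i
    funext τ
    simp only [f]
    ring
  have hint : ∀ i, Integrable (f i) (volume.restrict (Set.Ioo 0 t)) := by
    intro i
    rw [hf]
    exact (((intervalIntegrable_iff_integrableOn_Ioo_of_le ht.le).1
      (intervalIntegrable_fracKernel_conv (by positivity) (by positivity) ht)).const_mul _)
  have hval : ∀ i, ∫ τ in Set.Ioo 0 t, f i τ = lam ^ i.1 * sig ^ i.2 *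
      fracKernel ((α * i.1 + (α - v₁)) + (β * i.2 + (β - v₂))) t := by
    intro i
    rw [← integral_Ioc_eq_integral_Ioo, ← intervalIntegral.integral_of_le ht.le, hf,
      intervalIntegral.integral_const_mul,
      integral_fracKernel_conv (by positivity) (by positivity) ht]
  have hbase := (intervalIntegrable_iff_integrableOn_Ioo_of_le ht.le).1
    (intervalIntegrable_rpow_mul_rpow hp hq ht)
  let A : ℕ → ℝ := fun a => (‖lam‖ * t ^ α) ^ a * (Real.Gamma (α * a + (α - v₁)))⁻¹
  let B : ℕ → ℝ := fun b => (‖sig‖ * t ^ β) ^ b * (Real.Gamma (β * b + (β - v₂)))⁻¹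
  have hA : Summable A := summable_pow_mul_inv_Gamma hα _ (by positivity)
  have hB : Summable B := summable_pow_mul_inv_Gamma hβ _ (by positivity)
  have hA0 : ∀ a, 0 ≤ A a := fun a =>
    mul_nonneg (by positivity) (inv_nonneg.2 (Real.Gamma_pos_of_pos (by positivity)).le)
  have hB0 : ∀ b, 0 ≤ B b := fun b =>
    mul_nonneg (by positivity) (inv_nonneg.2 (Real.Gamma_pos_of_pos (by positivity)).le)
  have hsum : Summable fun i => ∫ τ in Set.Ioo 0 t, ‖f i τ‖ := by
    refine Summable.of_nonneg_of_le (fun i => integral_nonneg fun _ => norm_nonneg _) (fun i => ?_)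
      ((hA.mul_of_nonneg hB hA0 hB0).mul_right
        (∫ τ in Set.Ioo 0 t, (t - τ) ^ (α - v₁ - 1) * τ ^ (β - v₂ - 1)))
    rw [← integral_const_mul]
    refine setIntegral_mono_on (hint i).norm (hbase.const_mul _) measurableSet_Ioo fun τ hτ => ?_
    have h1 : 0 < t - τ := sub_pos.2 hτ.2
    calc ‖f i τ‖ ≤ (A i.1 * (t - τ) ^ (α - v₁ - 1)) * (B i.2 * τ ^ (β - v₂ - 1)) := by
          rw [norm_mul]
          refine mul_le_mul
            (norm_pow_mul_fracKernel_le hα hp h1 (by linarith [hτ.1]) lam i.1)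
            (norm_pow_mul_fracKernel_le hβ hq hτ.1 hτ.2.le sig i.2) (norm_nonneg _) ?_
          exact mul_nonneg (hA0 _) (Real.rpow_nonneg h1.le _)
      _ = _ := by ring
  have key := hasSum_integral_of_summable_integral_norm hint hsum
  simp only [hval] at key
  have heq : ∫ τ in (0 : ℝ)..t, Rfun α v₁ lam (t - τ) * Rfun β v₂ sig τ =
      ∫ τ in Set.Ioo 0 t, ∑' i, f i τ := by
    rw [intervalIntegral.integral_of_le ht.le, integral_Ioc_eq_integral_Ioo]
    refine setIntegral_congr_fun measurableSet_Ioo fun τ hτ => ?_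
    have h1 : 0 < t - τ := sub_pos.2 hτ.2
    simp only [f]
    rw [Rfun_eq_tsum_fracKernel _ _ _ h1, Rfun_eq_tsum_fracKernel _ _ _ hτ.1]
    exact tsum_mul_tsum_of_summable_norm (summable_norm_pow_mul_fracKernel hα hp h1 lam)
      (summable_norm_pow_mul_fracKernel hβ hq hτ.1 sig)
  rw [heq]
  exact key

theorem tsum_prod_eq_sum_range_add_tsum {F : ℕ × ℕ → ℂ} (hF : Summable F) (n : ℕ) :
    ∑' i, F i = ∑ k ∈ Finset.range n, ∑' b, F (k, b) + ∑' i : ℕ × ℕ, F (i.1 + n, i.2) := by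
  have hinj : Function.Injective fun i : ℕ × ℕ => (i.1 + n, i.2) := by
    rintro ⟨a, b⟩ ⟨c, d⟩ h
    simpa using h
  have hF' : Summable fun i : ℕ × ℕ => F (i.1 + n, i.2) := hF.comp_injective hinj
  rw [hF.tsum_prod, hF'.tsum_prod, ← hF.prod.sum_add_tsum_nat_add n]

/-- Convolution-to-sum identity for rationally related orders
(`R` functions): if `n, m` are coprime positive integers, `mα = nβ`, and
`λ^m ≠ σ^n`, then the convolution of `R_{α,v₁}(λ,·)` and `R_{β,v₂}(σ,·)` is a
sum of `n + m` `R` functions. -/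
theorem conv_Rfun_rational_orders (n m : ℕ) (hn : 0 < n) (hm : 0 < m)
    (hcop : Nat.Coprime n m) (α β : ℝ) (hα : 0 < α) (hβ : 0 < β)
    (hαβ : (m : ℝ) * α = (n : ℝ) * β) (lam sig : ℂ) (hls : lam ^ m ≠ sig ^ n)
    (v₁ v₂ : ℝ) (hv₁ : v₁ < α) (hv₂ : v₂ < β) (t : ℝ) (ht : 0 < t) :
    (∫ τ in (0 : ℝ)..t, Rfun α v₁ lam (t - τ) * Rfun β v₂ sig τ) =
      (∑ j ∈ Finset.range n,
        (sig ^ j * lam ^ m / (lam ^ m - sig ^ n)) *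
          Rfun α ((v₁ + v₂) - β * ((j : ℝ) + 1)) lam t) +
      ∑ k ∈ Finset.range m,
        (lam ^ k * sig ^ n / (sig ^ n - lam ^ m)) *
          Rfun β ((v₁ + v₂) - α * ((k : ℝ) + 1)) sig t := by
  have hconv := hasSum_Rfun_conv hα hβ lam sig hv₁ hv₂ ht
  set S := ∫ τ in (0 : ℝ)..t, Rfun α v₁ lam (t - τ) * Rfun β v₂ sig τ
  set F : ℕ × ℕ → ℂ := fun i => lam ^ i.1 * sig ^ i.2 *
    fracKernel ((α * i.1 + (α - v₁)) + (β * i.2 + (β - v₂))) t with hFdef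
  have hswap : HasSum (fun i : ℕ × ℕ => F i.swap) S :=
    (Equiv.prodComm ℕ ℕ).hasSum_iff.2 hconv
  have h1 := tsum_prod_eq_sum_range_add_tsum hswap.summable n
  have h2 := tsum_prod_eq_sum_range_add_tsum hconv.summable m
  rw [hswap.tsum_eq] at h1
  rw [hconv.tsum_eq] at h2
  have hR1 : ∀ j : ℕ, ∑' a, F (a, j) =
      sig ^ j * Rfun α ((v₁ + v₂) - β * ((j : ℝ) + 1)) lam t := by
    intro j
    rw [Rfun_eq_tsum_fracKernel _ _ _ ht, ← tsum_mul_left]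
    refine tsum_congr fun a => ?_
    simp only [hFdef]
    rw [show α * a + (α - (v₁ + v₂ - β * ((j : ℝ) + 1))) =
      α * a + (α - v₁) + (β * j + (β - v₂)) by ring]
    ring
  have hR2 : ∀ k : ℕ, ∑' b, F (k, b) =
      lam ^ k * Rfun β ((v₁ + v₂) - α * ((k : ℝ) + 1)) sig t := by
    intro k
    rw [Rfun_eq_tsum_fracKernel _ _ _ ht, ← tsum_mul_left]
    refine tsum_congr fun b => ?_
    simp only [hFdef]
    rw [show β * b + (β - (v₁ + v₂ - α * ((k : ℝ) + 1))) =
      α * k + (α - v₁) + (β * b + (β - v₂)) by ring]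
    ring
  have htail : lam ^ m * ∑' i : ℕ × ℕ, F (i.2, i.1 + n) =
      sig ^ n * ∑' i : ℕ × ℕ, F (i.1 + m, i.2) := by
    rw [← (Equiv.prodComm ℕ ℕ).tsum_eq fun i : ℕ × ℕ => F (i.2, i.1 + n), ← tsum_mul_left,
      ← tsum_mul_left]
    refine tsum_congr fun i => ?_
    simp only [hFdef, Equiv.prodComm_apply, Prod.fst_swap, Prod.snd_swap]
    push_cast
    rw [show α * i.1 + (α - v₁) + (β * (i.2 + n) + (β - v₂)) =
      α * (i.1 + m) + (α - v₁) + (β * i.2 + (β - v₂)) by linear_combination -hαβ]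
    ring
  simp only [Prod.swap_prod_mk, hR1] at h1
  simp only [hR2] at h2
  have hd : lam ^ m - sig ^ n ≠ 0 := sub_ne_zero.2 hls
  have hL : ∑ j ∈ Finset.range n, (sig ^ j * lam ^ m / (lam ^ m - sig ^ n)) *
      Rfun α ((v₁ + v₂) - β * ((j : ℝ) + 1)) lam t = lam ^ m / (lam ^ m - sig ^ n) *
      ∑ j ∈ Finset.range n, sig ^ j * Rfun α ((v₁ + v₂) - β * ((j : ℝ) + 1)) lam t := by
    rw [Finset.mul_sum]
    exact Finset.sum_congr rfl fun j _ => by ring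
  have hS : ∑ k ∈ Finset.range m, (lam ^ k * sig ^ n / (sig ^ n - lam ^ m)) *
      Rfun β ((v₁ + v₂) - α * ((k : ℝ) + 1)) sig t = -(sig ^ n / (lam ^ m - sig ^ n)) *
      ∑ k ∈ Finset.range m, lam ^ k * Rfun β ((v₁ + v₂) - α * ((k : ℝ) + 1)) sig t := by
    rw [Finset.mul_sum, ← neg_sub (lam ^ m)]
    exact Finset.sum_congr rfl fun k _ => by rw [div_neg]; ring
  rw [hL, hS]
  field_simp
  linear_combination lam ^ m * h1 - sig ^ n * h2 + htail
end

section
/- Repeated convolution of same-order R functions with pairwise distinct eigenvalues: let α > 0, let J ≥ 2, let λ₁, …, λ_J ∈ ℂ be pairwise distinct, let v₁, …, v_J < α, and set v = v₁ + ⋯ + v_J. Then for every t > 0 the J-fold causal convolution satisfies (R_{α,v₁}(λ₁,·) * R_{α,v₂}(λ₂,·) * ⋯ * R_{α,v_J}(λ_J,·))(t) = ∑_{j=1}^{J} ( ∏_{ℓ ≠ j} (λ_j − λ_ℓ)^{−1} ) R_{α, v}(λ_j, t), where R_{α,v} is defined by its series with the reciprocal Gamma convention even when v ≥ α. -/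
open MeasureTheory

/-- Causal convolution: `(f * g)(t) = ∫_0^t f(t-τ) g(τ) dτ`. -/
noncomputable def causalConv (f g : ℝ → ℂ) : ℝ → ℂ :=
  fun t => ∫ τ in (0 : ℝ)..t, f (t - τ) * g τ

/-- Iterated (left-associated) causal convolution of a list of functions, in order. -/
noncomputable def convFold : List (ℝ → ℂ) → (ℝ → ℂ)
  | [] => fun _ => 0
  | f :: fs => fs.foldl causalConv f

/-- The Riemann–Liouville kernel `t^{a-1} / Γ(a)`. -/
noncomputable def rlKernel (a t : ℝ) : ℝ :=
  t ^ (a - 1) * (Real.Gamma a)⁻¹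

lemma rlKernel_pos {a t : ℝ} (ha : 0 < a) (ht : 0 < t) : 0 < rlKernel a t :=
  mul_pos (Real.rpow_pos_of_pos ht _) (inv_pos.2 (Real.Gamma_pos_of_pos ha))

lemma ofReal_rlKernel {a t : ℝ} (ht : 0 ≤ t) :
    ((rlKernel a t : ℝ) : ℂ) = (t : ℂ) ^ ((a : ℂ) - 1) * (Complex.Gamma a)⁻¹ := by
  rw [rlKernel, Complex.ofReal_mul, Complex.ofReal_cpow ht, Complex.ofReal_inv,
    Complex.Gamma_ofReal]
  push_cast
  rfl

lemma integral_rlKernel_mul {a b t : ℝ} (ha : 0 < a) (hb : 0 < b) (ht : 0 < t) :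
    ∫ τ in (0 : ℝ)..t, rlKernel a (t - τ) * rlKernel b τ = rlKernel (a + b) t := by
  rw [← Complex.ofReal_inj, ← intervalIntegral.integral_ofReal]
  have hG : Complex.Gamma (b : ℂ) * Complex.Gamma a =
      Complex.Gamma (b + a) * Complex.betaIntegral b a :=
    Complex.Gamma_mul_Gamma_eq_betaIntegral (by simpa) (by simpa)
  have hab : Complex.Gamma ((b : ℂ) + a) ≠ 0 :=
    Complex.Gamma_ne_zero_of_re_pos (by simpa using add_pos hb ha)
  have ha' : Complex.Gamma (a : ℂ) ≠ 0 := Complex.Gamma_ne_zero_of_re_pos (by simpa)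
  have hb' : Complex.Gamma (b : ℂ) ≠ 0 := Complex.Gamma_ne_zero_of_re_pos (by simpa)
  calc ∫ τ in (0 : ℝ)..t, ((rlKernel a (t - τ) * rlKernel b τ : ℝ) : ℂ)
      = ∫ τ in (0 : ℝ)..t, ((Complex.Gamma a)⁻¹ * (Complex.Gamma b)⁻¹) *
          ((τ : ℂ) ^ ((b : ℂ) - 1) * ((t : ℂ) - τ) ^ ((a : ℂ) - 1)) := by
        refine intervalIntegral.integral_congr fun τ hτ => ?_
        rw [Set.uIcc_of_le ht.le] at hτ
        rw [Complex.ofReal_mul, ofReal_rlKernel (sub_nonneg.2 hτ.2), ofReal_rlKernel hτ.1]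
        push_cast
        ring
    _ = rlKernel (a + b) t := by
        rw [intervalIntegral.integral_const_mul, Complex.betaIntegral_scaled _ _ ht,
          ofReal_rlKernel ht.le]
        have : Complex.betaIntegral b a =
            Complex.Gamma b * Complex.Gamma a * (Complex.Gamma (b + a))⁻¹ := by
          rw [hG]; field_simp
        rw [this]
        push_cast
        rw [add_comm (a : ℂ) b]
        field_simp

lemma intervalIntegrable_rlKernel_mul {a b t : ℝ} (ha : 0 < a) (hb : 0 < b) (ht : 0 < t) :
    IntervalIntegrable (fun τ => rlKernel a (t - τ) * rlKernel b τ) volume 0 t := by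
  by_contra h
  have := integral_rlKernel_mul ha hb ht
  rw [intervalIntegral.integral_undef h] at this
  exact (rlKernel_pos (add_pos ha hb) ht).ne this

lemma rpow_mul_le_Gamma {M x : ℝ} (hM : 0 < M) (hx : 0 < x) :
    M ^ x * (Real.exp (-(M + 1)) / (M + 1)) ≤ Real.Gamma x := by
  have hint := Real.GammaIntegral_convergent hx
  have hsub : Set.Ioc M (M + 1) ⊆ Set.Ioi 0 := fun u hu => hM.trans hu.1
  rw [Real.Gamma_eq_integral hx]
  calc M ^ x * (Real.exp (-(M + 1)) / (M + 1))
      = ∫ _ in Set.Ioc M (M + 1), M ^ x * (Real.exp (-(M + 1)) / (M + 1)) := by simp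
    _ ≤ ∫ u in Set.Ioc M (M + 1), Real.exp (-u) * u ^ (x - 1) := by
        refine setIntegral_mono_on (integrableOn_const (by simp)) (hint.mono_set hsub) measurableSet_Ioc
          fun u hu => ?_
        have hu0 : 0 < u := hM.trans hu.1
        rw [Real.rpow_sub_one hu0.ne', mul_div_left_comm]
        have h1 := hu.1.le
        have h2 := hu.2
        gcongr
    _ ≤ ∫ u in Set.Ioi 0, Real.exp (-u) * u ^ (x - 1) := by
        refine setIntegral_mono_set hint ?_ hsub.eventuallyLE
        filter_upwards [ae_restrict_mem measurableSet_Ioi] with u hu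
        have : (0 : ℝ) < u := hu
        positivity

/-- For fixed `t`, the kernel decays faster than any exponential in its order. -/
lemma exists_rlKernel_le {t r : ℝ} (ht : 0 < t) (hr : 0 < r) :
    ∃ K, 0 ≤ K ∧ ∀ x, 0 < x → rlKernel x t ≤ K * r ^ x := by
  set M := t / r with hMdef
  have hM : 0 < M := div_pos ht hr
  set c := Real.exp (-(M + 1)) / (M + 1) with hc
  have hc0 : 0 < c := by positivity
  refine ⟨t⁻¹ * c⁻¹, by positivity, fun x hx => ?_⟩
  have hMx : 0 < M ^ x := Real.rpow_pos_of_pos hM x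
  have hinv : (Real.Gamma x)⁻¹ ≤ (M ^ x * c)⁻¹ :=
    inv_anti₀ (by positivity) (rpow_mul_le_Gamma hM hx)
  calc rlKernel x t ≤ t ^ (x - 1) * (M ^ x * c)⁻¹ := by
        rw [rlKernel]; gcongr
    _ = t⁻¹ * c⁻¹ * r ^ x := by
        have hrx : 0 < r ^ x := Real.rpow_pos_of_pos hr x
        have htx : 0 < t ^ x := Real.rpow_pos_of_pos ht x
        rw [Real.rpow_sub_one ht.ne', hMdef, Real.div_rpow ht.le hr.le]
        field_simp

/-- The power series `p` has positive radius of convergence. -/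
def HasPosRadius (p : PowerSeries ℂ) : Prop :=
  ∃ r : ℝ, 0 < r ∧ Summable fun n => ‖PowerSeries.coeff n p‖ * r ^ n

lemma Summable.norm_coeff_mul_pow_of_le {p : PowerSeries ℂ} {r s : ℝ}
    (h : Summable fun n => ‖PowerSeries.coeff n p‖ * r ^ n) (hs : 0 ≤ s) (hsr : s ≤ r) :
    Summable fun n => ‖PowerSeries.coeff n p‖ * s ^ n :=
  h.of_nonneg_of_le (fun _ => by positivity) fun _ => by gcongr

lemma HasPosRadius.exists_common {p q : PowerSeries ℂ} (hp : HasPosRadius p)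
    (hq : HasPosRadius q) : ∃ r : ℝ, 0 < r ∧
      (Summable fun n => ‖PowerSeries.coeff n p‖ * r ^ n) ∧
      Summable fun n => ‖PowerSeries.coeff n q‖ * r ^ n := by
  obtain ⟨r, hr, hpr⟩ := hp
  obtain ⟨s, hs, hqs⟩ := hq
  have h0 : 0 < min r s := lt_min hr hs
  exact ⟨min r s, h0, hpr.norm_coeff_mul_pow_of_le h0.le (min_le_left _ _),
    hqs.norm_coeff_mul_pow_of_le h0.le (min_le_right _ _)⟩

lemma HasPosRadius.mul {p q : PowerSeries ℂ} (hp : HasPosRadius p) (hq : HasPosRadius q) :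
    HasPosRadius (p * q) := by
  obtain ⟨r, hr, hpr, hqr⟩ := hp.exists_common hq
  have hnorm (p : PowerSeries ℂ) (n : ℕ) :
      ‖PowerSeries.coeff n p * (r : ℂ) ^ n‖ = ‖PowerSeries.coeff n p‖ * r ^ n := by
    simp [abs_of_pos hr]
  refine ⟨r, hr, ?_⟩
  have h := summable_norm_sum_mul_antidiagonal_of_summable_norm
    (f := fun n => PowerSeries.coeff n p * (r : ℂ) ^ n)
    (g := fun n => PowerSeries.coeff n q * (r : ℂ) ^ n)
    (by simpa only [hnorm] using hpr) (by simpa only [hnorm] using hqr)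
  refine h.congr fun n => ?_
  rw [← hnorm, PowerSeries.coeff_mul, Finset.sum_mul]
  refine congrArg _ (Finset.sum_congr rfl fun kl hkl => ?_)
  rw [← Finset.HasAntidiagonal.mem_antidiagonal.1 hkl, pow_add]
  ring

lemma hasPosRadius_geom (a : ℂ) : HasPosRadius (PowerSeries.mk fun n => a ^ n) := by
  refine ⟨(‖a‖ + 1)⁻¹, by positivity, ?_⟩
  simp only [PowerSeries.coeff_mk, norm_pow, ← mul_pow]
  refine summable_geometric_of_lt_one (by positivity) ?_
  rw [← div_eq_mul_inv, div_lt_one (by positivity)]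
  linarith

/-- The generalized power series `∑ pₙ t^{αn+μ-1} / Γ(αn+μ)`. -/
noncomputable def kernelSeries (α : ℝ) (p : PowerSeries ℂ) (μ t : ℝ) : ℂ :=
  ∑' n : ℕ, PowerSeries.coeff n p * (rlKernel (α * n + μ) t : ℂ)

lemma Rfun_eq_kernelSeries (α v : ℝ) (a : ℂ) {t : ℝ} (ht : 0 < t) :
    Rfun α v a t = kernelSeries α (PowerSeries.mk fun n => a ^ n) (α - v) t := by
  rw [Rfun, mlE, kernelSeries, ← tsum_mul_left]
  refine tsum_congr fun n => ?_
  rw [PowerSeries.coeff_mk, rlKernel, Complex.Gamma_ofReal, mul_pow, ← Complex.ofReal_pow,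
    ← Real.rpow_mul_natCast ht.le,
    show α * n + (α - v) - 1 = (α - v - 1) + α * n by ring, Real.rpow_add ht]
  push_cast
  ring

lemma HasPosRadius.summable_kernelSeries {α : ℝ} (hα : 0 < α) {p : PowerSeries ℂ}
    (hp : HasPosRadius p) (μ : ℝ) {t : ℝ} (ht : 0 < t) :
    Summable fun n : ℕ => ‖PowerSeries.coeff n p * (rlKernel (α * n + μ) t : ℂ)‖ := by
  obtain ⟨r, hr, hpr⟩ := hp
  obtain ⟨K, hK, hbound⟩ := exists_rlKernel_le ht (Real.rpow_pos_of_pos hr α⁻¹)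
  refine Summable.of_norm_bounded_eventually_nat
    (hpr.mul_left (K * (r ^ α⁻¹) ^ μ)) ?_
  have htend : Filter.Tendsto (fun n : ℕ => α * (n : ℝ) + μ) Filter.atTop Filter.atTop :=
    Filter.tendsto_atTop_add_const_right _ _
      (tendsto_natCast_atTop_atTop.const_mul_atTop hα)
  filter_upwards [htend.eventually_gt_atTop 0] with n hn
  have h := hbound _ hn
  rw [norm_norm, norm_mul, Complex.norm_real, Real.norm_of_nonneg (rlKernel_pos hn ht).le]
  calc _ ≤ ‖PowerSeries.coeff n p‖ * (K * (r ^ α⁻¹) ^ (α * n + μ)) := by gcongr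
    _ = _ := by
      rw [Real.rpow_add (by positivity), ← Real.rpow_mul hr.le, inv_mul_cancel_left₀ hα.ne',
        Real.rpow_natCast]
      ring

lemma summable_mul_rlKernel {α : ℝ} (hα : 0 < α) {p q : PowerSeries ℂ}
    (hp : HasPosRadius p) (hq : HasPosRadius q) {μ : ℝ} (hμ : 0 < μ) {t : ℝ} (ht : 0 < t) :
    Summable fun z : ℕ × ℕ => ‖PowerSeries.coeff z.1 p‖ * ‖PowerSeries.coeff z.2 q‖ *
      rlKernel (α * (z.1 + z.2 : ℕ) + μ) t := by
  obtain ⟨r, hr, hpr, hqr⟩ := hp.exists_common hq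
  obtain ⟨K, hK, hbound⟩ := exists_rlKernel_le ht (Real.rpow_pos_of_pos hr α⁻¹)
  have hpos (n : ℕ) : 0 < α * n + μ := by positivity
  refine ((hpr.mul_of_nonneg hqr (fun _ => by positivity) fun _ => by positivity).mul_left
    (K * (r ^ α⁻¹) ^ μ)).of_nonneg_of_le
    (fun z => mul_nonneg (by positivity) (rlKernel_pos (hpos _) ht).le) fun z => ?_
  calc _ ≤ ‖PowerSeries.coeff z.1 p‖ * ‖PowerSeries.coeff z.2 q‖ *
        (K * (r ^ α⁻¹) ^ (α * (z.1 + z.2 : ℕ) + μ)) := by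
        gcongr; exact hbound _ (hpos _)
    _ = _ := by
      rw [Real.rpow_add (by positivity), ← Real.rpow_mul hr.le, inv_mul_cancel_left₀ hα.ne',
        Real.rpow_natCast, pow_add]
      ring

lemma causalConv_congr {f f' g g' : ℝ → ℂ} (hf : ∀ t, 0 < t → f t = f' t)
    (hg : ∀ t, 0 < t → g t = g' t) {t : ℝ} (ht : 0 < t) :
    causalConv f g t = causalConv f' g' t := by
  refine intervalIntegral.integral_congr_ae ?_
  filter_upwards [compl_mem_ae_iff.2 (measure_singleton t)] with τ hτ hτt
  rw [Set.uIoc_of_le ht.le] at hτt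
  rw [hf _ (sub_pos.2 (lt_of_le_of_ne hτt.2 hτ)), hg _ hτt.1]

lemma causalConv_kernelSeries {α : ℝ} (hα : 0 < α) {p q : PowerSeries ℂ}
    (hp : HasPosRadius p) (hq : HasPosRadius q) {μ ν : ℝ} (hμ : 0 < μ) (hν : 0 < ν)
    {t : ℝ} (ht : 0 < t) :
    causalConv (kernelSeries α p μ) (kernelSeries α q ν) t =
      kernelSeries α (p * q) (μ + ν) t := by
  have hpos {σ : ℝ} (hσ : 0 < σ) (n : ℕ) : 0 < α * n + σ := by positivity
  have hadd (z : ℕ × ℕ) : (α * z.1 + μ) + (α * z.2 + ν) = α * (z.1 + z.2 : ℕ) + (μ + ν) := by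
    push_cast; ring
  let F : ℕ × ℕ → ℝ → ℂ := fun z τ =>
    (PowerSeries.coeff z.1 p * PowerSeries.coeff z.2 q) *
      ((rlKernel (α * z.1 + μ) (t - τ) * rlKernel (α * z.2 + ν) τ : ℝ) : ℂ)
  have hFint (z : ℕ × ℕ) : Integrable (F z) (volume.restrict (Set.Ioc 0 t)) :=
    (((intervalIntegrable_rlKernel_mul (hpos hμ z.1) (hpos hν z.2) ht).1).ofReal).const_mul _
  have hFval (z : ℕ × ℕ) : ∫ τ in Set.Ioc 0 t, F z τ =
      (PowerSeries.coeff z.1 p * PowerSeries.coeff z.2 q) *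
        (rlKernel (α * (z.1 + z.2 : ℕ) + (μ + ν)) t : ℂ) := by
    rw [integral_const_mul, integral_complex_ofReal, ← intervalIntegral.integral_of_le ht.le,
      integral_rlKernel_mul (hpos hμ z.1) (hpos hν z.2) ht, hadd]
  have hFnorm (z : ℕ × ℕ) : ∫ τ in Set.Ioc 0 t, ‖F z τ‖ =
      ‖PowerSeries.coeff z.1 p‖ * ‖PowerSeries.coeff z.2 q‖ *
        rlKernel (α * (z.1 + z.2 : ℕ) + (μ + ν)) t := by
    rw [← hadd, ← integral_rlKernel_mul (hpos hμ z.1) (hpos hν z.2) ht,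
      intervalIntegral.integral_of_le ht.le, ← integral_const_mul, integral_Ioc_eq_integral_Ioo,
      integral_Ioc_eq_integral_Ioo]
    refine setIntegral_congr_fun measurableSet_Ioo fun τ hτ => ?_
    have h1 := rlKernel_pos (hpos hμ z.1) (sub_pos.2 hτ.2)
    have h2 := rlKernel_pos (hpos hν z.2) hτ.1
    simp only [F, norm_mul, Complex.norm_real, Real.norm_of_nonneg h1.le,
      Real.norm_of_nonneg h2.le]
  have hsum := hasSum_integral_of_summable_integral_norm hFint
    (by simpa only [hFnorm] using summable_mul_rlKernel hα hp hq (add_pos hμ hν) ht)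
  simp only [hFval] at hsum
  have hconv : causalConv (kernelSeries α p μ) (kernelSeries α q ν) t =
      ∫ τ in Set.Ioc 0 t, ∑' z, F z τ := by
    rw [causalConv, intervalIntegral.integral_of_le ht.le, integral_Ioc_eq_integral_Ioo,
      integral_Ioc_eq_integral_Ioo]
    refine setIntegral_congr_fun measurableSet_Ioo fun τ hτ => ?_
    simp only [kernelSeries, F]
    rw [tsum_mul_tsum_of_summable_norm (hp.summable_kernelSeries hα μ (sub_pos.2 hτ.2))
      (hq.summable_kernelSeries hα ν hτ.1)]
    refine tsum_congr fun z => ?_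
    push_cast
    ring
  rw [hconv, kernelSeries]
  refine (((Finset.HasAntidiagonal.sigmaAntidiagonalEquivProd (A := ℕ)).hasSum_iff.2 hsum).sigma
    fun n => ?_).tsum_eq.symm
  rw [PowerSeries.coeff_mul, Finset.sum_mul, ← Finset.sum_coe_sort]
  convert hasSum_fintype _ using 2 with z
  change _ = _ * ((rlKernel (α * (z.1.1 + z.1.2 : ℕ) + (μ + ν)) t : ℝ) : ℂ)
  rw [Finset.HasAntidiagonal.mem_antidiagonal.1 z.2]
  rfl

lemma foldl_causalConv_Rfun {ι : Type*} {α : ℝ} (hα : 0 < α) (lam : ι → ℂ) (v : ι → ℝ)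
    (hv : ∀ i, v i < α) (l : List ι) {f : ℝ → ℂ} {p : PowerSeries ℂ} {μ : ℝ}
    (hp : HasPosRadius p) (hμ : 0 < μ) (hf : ∀ t, 0 < t → f t = kernelSeries α p μ t)
    {t : ℝ} (ht : 0 < t) :
    (l.map fun i => Rfun α (v i) (lam i)).foldl causalConv f t =
      kernelSeries α (p * (l.map fun i => PowerSeries.mk fun n => lam i ^ n).prod)
        (μ + (l.map fun i => α - v i).sum) t := by
  induction l generalizing f p μ with
  | nil => simpa using hf t ht
  | cons i l ih =>
    simp only [List.map_cons, List.foldl_cons, List.prod_cons, List.sum_cons]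
    rw [← mul_assoc, ← add_assoc]
    have hi : 0 < α - v i := sub_pos.2 (hv i)
    refine ih (hp.mul (hasPosRadius_geom _)) (add_pos hμ hi) fun s hs => ?_
    rw [causalConv_congr hf (fun s hs => Rfun_eq_kernelSeries α (v i) (lam i) hs) hs,
      causalConv_kernelSeries hα hp (hasPosRadius_geom _) hμ hi hs]

lemma kernelSeries_X_pow_mul (α : ℝ) (p : PowerSeries ℂ) (k : ℕ) (μ t : ℝ) :
    kernelSeries α (PowerSeries.X ^ k * p) μ t = kernelSeries α p (μ + α * k) t := by
  rw [kernelSeries, kernelSeries, ← (add_left_injective k).tsum_eq]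
  · refine tsum_congr fun n => ?_
    rw [PowerSeries.coeff_X_pow_mul]
    push_cast
    ring_nf
  · intro n hn
    rw [Function.mem_support, PowerSeries.coeff_X_pow_mul'] at hn
    have hk : k ≤ n := by
      by_contra h
      simp [h] at hn
    exact ⟨n - k, Nat.sub_add_cancel hk⟩

lemma kernelSeries_sum {ι : Type*} {α : ℝ} (hα : 0 < α) (s : Finset ι) (w : ι → ℂ)
    (p : ι → PowerSeries ℂ) (hp : ∀ i ∈ s, HasPosRadius (p i)) (μ : ℝ) {t : ℝ} (ht : 0 < t) :
    kernelSeries α (∑ i ∈ s, PowerSeries.C (w i) * p i) μ t =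
      ∑ i ∈ s, w i * kernelSeries α (p i) μ t := by
  simp only [kernelSeries, ← tsum_mul_left]
  rw [← Summable.tsum_finsetSum fun i hi =>
    ((hp i hi).summable_kernelSeries hα μ ht).of_norm.mul_left (w i)]
  refine tsum_congr fun n => ?_
  simp only [map_sum, PowerSeries.coeff_C_mul, Finset.sum_mul, mul_assoc]

lemma one_sub_mul_geom (a : ℂ) :
    (1 - PowerSeries.C a * PowerSeries.X) * (PowerSeries.mk fun n => a ^ n) = 1 := by
  ext n
  cases n with
  | zero => simp [sub_mul, mul_assoc]
  | succ n =>
    simp [sub_mul, mul_assoc, PowerSeries.coeff_succ_X_mul, pow_succ', PowerSeries.coeff_one]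

open Polynomial in
lemma sum_prod_inv_mul_prod_one_sub {K ι : Type*} [Field K] [Infinite K] [DecidableEq ι]
    (s : Finset ι) (hs : s.Nonempty) (x : ι → K) (hx : Set.InjOn x s) :
    ∑ j ∈ s, C (∏ l ∈ s.erase j, (x j - x l)⁻¹) * ∏ l ∈ s.erase j, (1 - C (x l) * X) =
      (X ^ (s.card - 1) : K[X]) := by
  refine eq_of_infinite_eval_eq _ _ ((Set.finite_singleton (0 : K)).infinite_compl.mono ?_)
  intro y hy
  have hy : y ≠ 0 := hy
  have h := congrArg (eval y⁻¹) (Lagrange.sum_basis hx hs)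
  simp only [Lagrange.basis, Lagrange.basisDivisor, eval_finsetSum, eval_prod, eval_mul,
    eval_C, eval_sub, eval_X, eval_one, Finset.prod_mul_distrib] at h
  simp only [Set.mem_ofPred_eq, eval_finsetSum, eval_prod, eval_mul,
    eval_C, eval_sub, eval_X, eval_one, eval_pow]
  conv_rhs => rw [← mul_one (y ^ _), ← h, Finset.mul_sum]
  refine Finset.sum_congr rfl fun j hj => ?_
  rw [mul_left_comm (y ^ _), ← Finset.card_erase_of_mem hj, ← Finset.prod_const,
    ← Finset.prod_mul_distrib (f := fun _ => y)]
  refine congrArg _ (Finset.prod_congr rfl fun l _ => ?_)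
  field_simp

lemma sum_geom_eq_X_pow_mul_prod {ι : Type*} [DecidableEq ι]
    (s : Finset ι) (hs : s.Nonempty) (x : ι → ℂ) (hx : Set.InjOn x s) :
    ∑ j ∈ s, PowerSeries.C (∏ l ∈ s.erase j, (x j - x l)⁻¹) * (PowerSeries.mk fun n => x j ^ n) =
      PowerSeries.X ^ (s.card - 1) * ∏ j ∈ s, PowerSeries.mk fun n => x j ^ n := by
  have h := congrArg Polynomial.coeToPowerSeries.ringHom
    (sum_prod_inv_mul_prod_one_sub s hs x hx)
  simp only [map_sum, map_mul, map_prod, map_sub, map_one, map_pow,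
    Polynomial.coeToPowerSeries.ringHom_apply, Polynomial.coe_C, Polynomial.coe_X] at h
  rw [← h, Finset.sum_mul]
  refine Finset.sum_congr rfl fun j hj => ?_
  rw [mul_assoc, ← Finset.mul_prod_erase s _ hj,
    mul_left_comm (∏ l ∈ s.erase j, (1 - PowerSeries.C (x l) * PowerSeries.X)),
    ← Finset.prod_mul_distrib]
  simp only [map_prod, one_sub_mul_geom, Finset.prod_const_one, mul_one]

/-- Repeated convolution of same-order `R` functions with pairwise
distinct eigenvalues: the `J`-fold causal convolution of `R_{α,v₁}(λ₁,·), …,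
R_{α,v_J}(λ_J,·)` equals `∑_j (∏_{ℓ≠j} (λ_j-λ_ℓ)⁻¹) R_{α,v}(λ_j,t)` with
`v = v₁ + ⋯ + v_J` (the `R` function given by its series with the reciprocal
Gamma convention, valid even when `v ≥ α`). -/
theorem conv_Rfun_repeated (α : ℝ) (hα : 0 < α) (J : ℕ) (hJ : 2 ≤ J)
    (lam : Fin J → ℂ) (hdist : Function.Injective lam)
    (v : Fin J → ℝ) (hv : ∀ j, v j < α) (t : ℝ) (ht : 0 < t) :
    convFold (List.ofFn (fun j : Fin J => Rfun α (v j) (lam j))) t =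
      ∑ j : Fin J,
        (∏ ℓ ∈ Finset.univ.erase j, (lam j - lam ℓ)⁻¹) *
          Rfun α (∑ i : Fin J, v i) (lam j) t := by
  obtain ⟨k, rfl⟩ : ∃ k, J = k + 1 := ⟨J - 1, by omega⟩
  have hprod := List.prod_ofFn (f := fun j => PowerSeries.mk fun n => lam j ^ n)
  have hsum := List.sum_ofFn (f := fun j => α - v j)
  rw [List.ofFn_eq_map, List.finRange_succ, List.map_cons, List.prod_cons] at hprod
  rw [List.ofFn_eq_map, List.finRange_succ, List.map_cons, List.sum_cons] at hsum
  rw [List.ofFn_eq_map, List.finRange_succ, List.map_cons, convFold,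
    foldl_causalConv_Rfun hα lam v hv _ (hasPosRadius_geom (lam 0)) (sub_pos.2 (hv 0))
      (fun s hs => Rfun_eq_kernelSeries α (v 0) (lam 0) hs) ht, hprod, hsum]
  simp only [Rfun_eq_kernelSeries α _ _ ht]
  rw [← kernelSeries_sum hα _ _ _ (fun j _ => hasPosRadius_geom (lam j)) _ ht,
    sum_geom_eq_X_pow_mul_prod _ Finset.univ_nonempty lam hdist.injOn, kernelSeries_X_pow_mul]
  congr 1
  simp only [Finset.sum_sub_distrib, Finset.sum_const, Finset.card_univ, Fintype.card_fin,
    nsmul_eq_mul, Nat.add_sub_cancel]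
  push_cast
  ring
end
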